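/- Let p be a prime and B a commutative ring. In the ring TruncatedWittVector p 2 B of length-2 p-typical truncated Witt vectors, for all a₀, a₁, b₀, b₁ ∈ B the Witt vector with coordinates (a₀, a₁) plus the one with coordinates (b₀, b₁) equals the Witt vector with coordinates (a₀ + b₀, a₁ + b₁ − ∑_{j=1}^{p−1} (C(p,j)/p)·a₀^{p−j}·b₀^j), and their product equals the Witt vector with coordinates (a₀·b₀, a₁·b₀^p + a₀^p·b₁ + p·a₁·b₁). -/

import Mathlib

namespace WittVector

open MvPolynomial

/-- The binomial expansion of `(x + y) ^ p`, with the mixed terms divided by the prime `p`. -/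
theorem add_pow_prime_eq_add_mul_sum_choose_div (p : ℕ) [hp : Fact p.Prime] {R : Type*}
    [CommRing R] (x y : R) :
    (x + y) ^ p = x ^ p + y ^ p +
      (p : R) * ∑ j ∈ Finset.Ico 1 p, ((p.choose j / p : ℕ) : R) * x ^ (p - j) * y ^ j := by
  rw [add_comm x y, add_pow, Finset.sum_range_succ, Finset.range_eq_Ico,
    Finset.sum_eq_sum_Ico_succ_bot hp.out.pos, Finset.mul_sum]
  have h : ∀ j ∈ Finset.Ico 1 p, y ^ j * x ^ (p - j) * (p.choose j : R) =
      (p : R) * (((p.choose j / p : ℕ) : R) * x ^ (p - j) * y ^ j) := by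
    intro j hj
    obtain ⟨hj₁, hj₂⟩ := Finset.mem_Ico.mp hj
    have hdvd := Nat.mul_div_cancel' (hp.out.dvd_choose_self (by lia) hj₂)
    conv_lhs => rw [← hdvd]
    push_cast
    ring
  rw [Finset.sum_congr rfl h]
  simp
  ring

/-- The structure polynomial of index one is determined by the first ghost component. -/
theorem wittStructureInt_one_prop (p : ℕ) [hp : Fact p.Prime] {idx : Type*}
    (Φ : MvPolynomial idx ℤ) :
    wittStructureInt p Φ 0 ^ p + (p : MvPolynomial (idx × ℕ) ℤ) * wittStructureInt p Φ 1 =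
      bind₁ (fun i => X (i, 0) ^ p + (p : MvPolynomial (idx × ℕ) ℤ) * X (i, 1)) Φ := by
  have h := wittStructureInt_prop p Φ 1
  simp only [wittPolynomial_one, map_add, map_mul, map_pow, bind₁_X_right, rename_X,
    map_natCast] at h
  simpa only [add_comm] using h

theorem wittAdd_one (p : ℕ) [hp : Fact p.Prime] :
    wittAdd p 1 = X (0, 1) + X (1, 1) -
      ∑ j ∈ Finset.Ico 1 p, ((p.choose j / p : ℕ) : MvPolynomial (Fin 2 × ℕ) ℤ) *
        X (0, 0) ^ (p - j) * X (1, 0) ^ j := by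
  have h := wittStructureInt_one_prop p (X 0 + X 1 : MvPolynomial (Fin 2) ℤ)
  change wittAdd p 0 ^ p + _ * wittAdd p 1 = _ at h
  rw [wittAdd_zero, add_pow_prime_eq_add_mul_sum_choose_div] at h
  simp only [map_add, bind₁_X_right] at h
  have hp0 : (p : MvPolynomial (Fin 2 × ℕ) ℤ) ≠ 0 := Nat.cast_ne_zero.mpr hp.out.ne_zero
  apply mul_left_cancel₀ hp0
  linear_combination h

theorem wittMul_one (p : ℕ) [hp : Fact p.Prime] :
    wittMul p 1 = X (0, 1) * X (1, 0) ^ p + X (0, 0) ^ p * X (1, 1) +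
      (p : MvPolynomial (Fin 2 × ℕ) ℤ) * X (0, 1) * X (1, 1) := by
  have h := wittStructureInt_one_prop p (X 0 * X 1 : MvPolynomial (Fin 2) ℤ)
  change wittMul p 0 ^ p + _ * wittMul p 1 = _ at h
  rw [wittMul_zero] at h
  simp only [map_mul, bind₁_X_right] at h
  have hp0 : (p : MvPolynomial (Fin 2 × ℕ) ℤ) ≠ 0 := Nat.cast_ne_zero.mpr hp.out.ne_zero
  apply mul_left_cancel₀ hp0
  linear_combination h

theorem add_coeff_one (p : ℕ) [hp : Fact p.Prime] {R : Type*} [CommRing R]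
    (x y : WittVector p R) :
    (x + y).coeff 1 = x.coeff 1 + y.coeff 1 -
      ∑ j ∈ Finset.Ico 1 p,
        ((p.choose j / p : ℕ) : R) * x.coeff 0 ^ (p - j) * y.coeff 0 ^ j := by
  rw [add_coeff, wittAdd_one]
  simp [peval]

theorem mul_coeff_one (p : ℕ) [hp : Fact p.Prime] {R : Type*} [CommRing R]
    (x y : WittVector p R) :
    (x * y).coeff 1 = x.coeff 1 * y.coeff 0 ^ p + x.coeff 0 ^ p * y.coeff 1 +
      (p : R) * x.coeff 1 * y.coeff 1 := by
  rw [mul_coeff, wittMul_one]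
  simp [peval]

end WittVector

/-- Explicit addition and multiplication laws for length-2 truncated
`p`-typical Witt vectors in terms of their two coordinates. -/
theorem truncatedWittVector_two_add_mul
    (p : ℕ) [hp : Fact p.Prime] {B : Type*} [CommRing B] (a₀ a₁ b₀ b₁ : B) :
    TruncatedWittVector.mk p ![a₀, a₁] + TruncatedWittVector.mk p ![b₀, b₁] =
        TruncatedWittVector.mk p
          ![a₀ + b₀,
            a₁ + b₁ -
              ∑ j ∈ Finset.Ico 1 p,
                ((p.choose j / p : ℕ) : B) * a₀ ^ (p - j) * b₀ ^ j] ∧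
      TruncatedWittVector.mk p ![a₀, a₁] * TruncatedWittVector.mk p ![b₀, b₁] =
        TruncatedWittVector.mk p
          ![a₀ * b₀, a₁ * b₀ ^ p + a₀ ^ p * b₁ + (p : B) * a₁ * b₁] := by
  have out_zero (c₀ c₁ : B) : (TruncatedWittVector.mk p ![c₀, c₁]).out.coeff 0 = c₀ :=
    TruncatedWittVector.coeff_out _ 0
  have out_one (c₀ c₁ : B) : (TruncatedWittVector.mk p ![c₀, c₁]).out.coeff 1 = c₁ :=
    TruncatedWittVector.coeff_out _ 1
  rw [← TruncatedWittVector.truncateFun_out (TruncatedWittVector.mk p ![a₀, a₁]),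
    ← TruncatedWittVector.truncateFun_out (TruncatedWittVector.mk p ![b₀, b₁]),
    ← WittVector.truncateFun_add, ← WittVector.truncateFun_mul]
  constructor <;> ext i <;> fin_cases i <;>
    simp [WittVector.coeff_truncateFun, WittVector.add_coeff_zero, WittVector.mul_coeff_zero,
      WittVector.add_coeff_one, WittVector.mul_coeff_one, out_zero, out_one,
      -WittVector.truncateFun_add, -WittVector.truncateFun_mul]
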